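/- arXiv:1510.03337 — 8 statements merged into one kernel-verified Lean document; each statement's English description precedes it below -/
import Mathlib

section
/- One has i'(sl(n+1,ℝ)) + p̃ = so(n+1,n+1): every X ∈ so(n+1,n+1) can be written as X = i'(A) + Y with A ∈ sl(n+1,ℝ) and Y ∈ p̃. (This is the infinitesimal openness of the G-orbit of the origin in G̃/P̃, a standing assumption of the Fefferman-type construction, verified in Section 3.3.) -/
open Matrix

noncomputable section

/-- Index type for `(2n+2)×(2n+2)` matrices split into two blocks of size `n+1`. -/
abbrev Idx (n : ℕ) : Type := Fin (n + 1) ⊕ Fin (n + 1)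

/-- The split-signature Gram matrix `J = [[0,I],[I,0]]`. -/
def Jmat (n : ℕ) : Matrix (Idx n) (Idx n) ℝ := Matrix.fromBlocks 0 1 1 0

/-- The Lie algebra `so(n+1,n+1) = {X : XᵀJ + JX = 0}`. -/
def soSplit (n : ℕ) : Set (Matrix (Idx n) (Idx n) ℝ) :=
  {X | Xᵀ * Jmat n + Jmat n * X = 0}

/-- The block embedding `i'(A) = [[A,0],[0,−Aᵀ]]`. -/
def iEmb {n : ℕ} (A : Matrix (Fin (n + 1)) (Fin (n + 1)) ℝ) : Matrix (Idx n) (Idx n) ℝ :=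
  Matrix.fromBlocks A 0 0 (-Aᵀ)

/-- The light-like vector `ṽ = e₁ + e_{2n+2}`. -/
def vtil (n : ℕ) : Idx n → ℝ :=
  Pi.single (Sum.inl 0) 1 + Pi.single (Sum.inr (Fin.last n)) 1

/-- The stabilizer subalgebra `p̃ = {X ∈ so(n+1,n+1) : Xṽ ∈ ℝṽ}`. -/
def ptil (n : ℕ) : Set (Matrix (Idx n) (Idx n) ℝ) :=
  {X ∈ soSplit n | ∃ c : ℝ, X.mulVec (vtil n) = c • vtil n}

/-- Membership in `so(n+1,n+1)` in block form. -/
theorem fromBlocks_mem_soSplit_iff {n : ℕ} (A B C D : Matrix (Fin (n + 1)) (Fin (n + 1)) ℝ) :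
    Matrix.fromBlocks A B C D ∈ soSplit n ↔ D = -Aᵀ ∧ Bᵀ = -B ∧ Cᵀ = -C := by
  have h : ∀ M N : Matrix (Fin (n + 1)) (Fin (n + 1)) ℝ, M + N = 0 ↔ M = -N :=
    fun M N => add_eq_zero_iff_eq_neg
  simp only [soSplit, Jmat, Set.mem_ofPred_eq, Matrix.fromBlocks_transpose,
    Matrix.fromBlocks_multiply, Matrix.fromBlocks_add, ← Matrix.fromBlocks_zero,
    Matrix.fromBlocks_inj, mul_zero, mul_one, zero_mul, one_mul, zero_add, add_zero, h]
  constructor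
  · rintro ⟨hC, hA, -, hB⟩
    exact ⟨by rw [hA, neg_neg], hB, hC⟩
  · rintro ⟨hD, hB, hC⟩
    subst hD
    simp [hB, hC]

/-- A matrix with prescribed trace whose first column and last row are prescribed, provided both
vanish at the common corner. -/
theorem exists_matrix_col_row_trace {n : ℕ} (hn : 2 ≤ n) (u v : Fin (n + 1) → ℝ)
    (hu : u (Fin.last n) = 0) (hv : v 0 = 0) (r : ℝ) :
    ∃ E : Matrix (Fin (n + 1)) (Fin (n + 1)) ℝ,
      (∀ i, E i 0 = u i) ∧ (∀ j, E (Fin.last n) j = v j) ∧ E.trace = r := by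
  obtain ⟨m, hm0, hml⟩ : ∃ m : Fin (n + 1), m ≠ 0 ∧ m ≠ Fin.last n :=
    ⟨⟨1, by omega⟩, by simp [Fin.ext_iff], by simp [Fin.ext_iff]; omega⟩
  refine ⟨Matrix.vecMulVec u (Pi.single 0 1) + Matrix.vecMulVec (Pi.single (Fin.last n) 1) v +
    Matrix.single m m (r - u 0 - v (Fin.last n)), fun i => ?_, fun j => ?_, ?_⟩
  · simp [Matrix.vecMulVec_apply, hv, hm0]
  · simp [Matrix.vecMulVec_apply, hu, hml]
  · simp [Matrix.trace_add, Matrix.trace_vecMulVec]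

/-- `i'(sl(n+1,ℝ)) + p̃ = so(n+1,n+1)`: every `X ∈ so(n+1,n+1)` is
`X = i'(A) + Y` with `A` trace-free and `Y ∈ p̃`. -/
theorem stmt5 (n : ℕ) (hn : 2 ≤ n) (X : Matrix (Idx n) (Idx n) ℝ) (hX : X ∈ soSplit n) :
    ∃ (A : Matrix (Fin (n + 1)) (Fin (n + 1)) ℝ) (Y : Matrix (Idx n) (Idx n) ℝ),
      A.trace = 0 ∧ Y ∈ ptil n ∧ X = iEmb A + Y := by
  obtain ⟨B, C, D, F, rfl⟩ : ∃ B C D F, X = Matrix.fromBlocks B C D F :=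
    ⟨_, _, _, _, (Matrix.fromBlocks_toBlocks X).symm⟩
  obtain ⟨rfl, hC, hD⟩ := (fromBlocks_mem_soSplit_iff B C D F).1 hX
  have diag_zero : ∀ M : Matrix (Fin (n + 1)) (Fin (n + 1)) ℝ, Mᵀ = -M → ∀ i, M i i = 0 := by
    intro M hM i
    have h : M i i = -M i i := congrFun (congrFun hM i) i
    linarith
  obtain ⟨E, hcol, hrow, htr⟩ := exists_matrix_col_row_trace hn (fun i => -C i (Fin.last n))
    (fun j => D j 0) (by simp [diag_zero C hC]) (diag_zero D hD 0) B.trace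
  refine ⟨B - E, Matrix.fromBlocks E C D (-Eᵀ), by simp [htr],
    ⟨(fromBlocks_mem_soSplit_iff E C D _).2 ⟨rfl, hC, hD⟩, 0, ?_⟩, ?_⟩
  · ext (i | i) <;> simp [vtil, Matrix.mulVec_add, hcol, hrow]
  · simp [iEmb, Matrix.fromBlocks_add, sub_add_eq_add_sub]
end
end

section
/- The embedded special linear group acts transitively on the open orbit of null rays: for every v ∈ ℝ^{2n+2} with h(v,v) = 0, v ∉ E and v ∉ F, there exist g ∈ SL(n+1,ℝ) and a real t > 0 such that M(g)·v = t·ṽ, where ṽ = e₁ + e_{2n+2}. (Section 3.3: the G-orbit of the origin in G̃/P̃ consists of the isotropic rays neither contained in E nor in F.) -/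
open Matrix

noncomputable section

/-- The split inner product `h(x,y) = xᵀJy`. -/
def hform (n : ℕ) (x y : Idx n → ℝ) : ℝ := x ⬝ᵥ (Jmat n).mulVec y

/-- The isotropic subspace `E = span(e₁,…,e_{n+1})`. -/
def Eset (n : ℕ) : Set (Idx n → ℝ) := {v | ∀ j : Fin (n + 1), v (Sum.inr j) = 0}

/-- The isotropic subspace `F = span(e_{n+2},…,e_{2n+2})`. -/
def Fset (n : ℕ) : Set (Idx n → ℝ) := {v | ∀ i : Fin (n + 1), v (Sum.inl i) = 0}

/-- The block embedding `M(g) = [[g,0],[0,(g⁻¹)ᵀ]]` of `SL(n+1,ℝ)`. -/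
def Memb {n : ℕ} (g : Matrix (Fin (n + 1)) (Fin (n + 1)) ℝ) : Matrix (Idx n) (Idx n) ℝ :=
  Matrix.fromBlocks g 0 0 (g⁻¹)ᵀ

/-- Two nonzero orthogonal vectors are the first column and, up to a factor, the last column of a
matrix with orthonormal columns. -/
theorem exists_matrix_orthonormal_columns {n : ℕ} (hn : 2 ≤ n) (x y : Fin (n + 1) → ℝ)
    (hx : x ≠ 0) (hy : y ≠ 0) (hxy : x ⬝ᵥ y = 0) :
    ∃ (O : Matrix (Fin (n + 1)) (Fin (n + 1)) ℝ) (a b : ℝ), Oᵀ * O = 1 ∧ a ≠ 0 ∧ b ≠ 0 ∧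
      O *ᵥ Pi.single 0 a = x ∧ O *ᵥ Pi.single (Fin.last n) b = y := by
  have h0 : (0 : Fin (n + 1)) ≠ Fin.last n := by
    rw [Ne, Fin.ext_iff, Fin.val_zero, Fin.val_last]
    omega
  let X : EuclideanSpace ℝ (Fin (n + 1)) := WithLp.toLp 2 x
  let Y : EuclideanSpace ℝ (Fin (n + 1)) := WithLp.toLp 2 y
  have hX : X ≠ 0 := fun h => hx (by simpa [X] using h)
  have hY : Y ≠ 0 := fun h => hy (by simpa [Y] using h)
  have hXn : ‖X‖ ≠ 0 := norm_ne_zero_iff.2 hX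
  have hYn : ‖Y‖ ≠ 0 := norm_ne_zero_iff.2 hY
  have hXY : inner ℝ X Y = 0 := by
    simpa [X, Y, EuclideanSpace.inner_toLp_toLp, dotProduct_comm] using hxy
  have hYX : inner ℝ Y X = 0 := by rw [real_inner_comm]; exact hXY
  let v : Fin (n + 1) → EuclideanSpace ℝ (Fin (n + 1)) :=
    fun i => if i = 0 then ‖X‖⁻¹ • X else ‖Y‖⁻¹ • Y
  have hv : Orthonormal ℝ (({0, Fin.last n} : Set (Fin (n + 1))).domRestrict v) := by
    constructor
    · rintro ⟨i, hi | hi⟩ <;> subst hi <;>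
        simp [Set.domRestrict_apply, v, h0.symm, norm_smul, hXn, hYn]
    · rintro ⟨i, hi | hi⟩ ⟨j, hj | hj⟩ hij <;> subst hi <;> subst hj <;>
        simp_all [Set.domRestrict_apply, v, inner_smul_left, inner_smul_right]
  obtain ⟨b, hb⟩ := hv.exists_orthonormalBasis_extension_of_card_eq (by simp)
  refine ⟨Matrix.of fun i j => b j i, ‖X‖, ‖Y‖, ?_, hXn, hYn, ?_, ?_⟩
  · ext i j
    have h := orthonormal_iff_ite.1 b.orthonormal i j
    rw [Matrix.one_apply, ← h]
    simp [Matrix.mul_apply, PiLp.inner_apply, mul_comm]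
  · ext i
    simp [Matrix.mulVec_single, hb 0 (by simp), v, mul_comm _ ‖X‖, mul_inv_cancel_left₀ hXn]
    rfl
  · ext i
    simp [Matrix.mulVec_single, hb (Fin.last n) (by simp), v, mul_comm _ ‖Y‖,
      mul_inv_cancel_left₀ hYn, h0.symm]
    rfl

/-- For nonzero `x`, `y` with `x ⬝ᵥ y = 0` there is a unimodular matrix `A` with first column `x`
and `Aᵀ y` equal to the last basis vector. -/
theorem exists_det_one_mulVec_single {n : ℕ} (hn : 2 ≤ n) (x y : Fin (n + 1) → ℝ)
    (hx : x ≠ 0) (hy : y ≠ 0) (hxy : x ⬝ᵥ y = 0) :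
    ∃ A : Matrix (Fin (n + 1)) (Fin (n + 1)) ℝ, A.det = 1 ∧
      A *ᵥ Pi.single 0 1 = x ∧ Aᵀ *ᵥ y = Pi.single (Fin.last n) 1 := by
  obtain ⟨O, a, b, hO, ha, hb, hOx, hOy⟩ := exists_matrix_orthonormal_columns hn x y hx hy hxy
  have hdet : O.det ≠ 0 := by
    intro h
    simpa [h] using congrArg Matrix.det hO
  let k : Fin (n + 1) := ⟨1, by omega⟩
  have hk0 : k ≠ 0 := by simp [k, Fin.ext_iff]
  have hkl : k ≠ Fin.last n := by simp [k, Fin.ext_iff]; omega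
  have hne : (0 : Fin (n + 1)) ≠ Fin.last n := by
    rw [Ne, Fin.ext_iff, Fin.val_zero, Fin.val_last]
    omega
  let d : Fin (n + 1) → ℝ := fun j => if j = 0 then a else if j = Fin.last n then b⁻¹ else 1
  have hd : ∏ j ∈ Finset.univ \ {k}, d j ≠ 0 := by
    refine Finset.prod_ne_zero_iff.2 fun j _ => ?_
    simp only [d]
    split_ifs <;> simp [ha, hb]
  let e : Fin (n + 1) → ℝ := Function.update d k (O.det * ∏ j ∈ Finset.univ \ {k}, d j)⁻¹
  have he0 : e 0 = a := by simp [e, hk0.symm, d]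
  have hel : e (Fin.last n) = b⁻¹ := by simp [e, hkl.symm, d, hne.symm]
  refine ⟨O * Matrix.diagonal e, ?_, ?_, ?_⟩
  · rw [Matrix.det_mul, Matrix.det_diagonal, Finset.prod_update_of_mem (Finset.mem_univ k)]
    field_simp
  · rw [← Matrix.mulVec_mulVec, Matrix.diagonal_mulVec_single, he0, mul_one, hOx]
  · rw [← hOy, Matrix.mulVec_mulVec, Matrix.transpose_mul, Matrix.mul_assoc, hO, Matrix.mul_one,
      Matrix.diagonal_transpose, Matrix.diagonal_mulVec_single, hel, inv_mul_cancel₀ hb]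

/-- the embedded `SL(n+1,ℝ)` acts transitively on the open orbit of null
rays: any null vector `v ∉ E ∪ F` can be mapped to a positive multiple of `ṽ`. -/
theorem stmt7 (n : ℕ) (hn : 2 ≤ n) (v : Idx n → ℝ)
    (hnull : hform n v v = 0) (hE : v ∉ Eset n) (hF : v ∉ Fset n) :
    ∃ (g : Matrix (Fin (n + 1)) (Fin (n + 1)) ℝ) (t : ℝ),
      g.det = 1 ∧ 0 < t ∧ (Memb g).mulVec v = t • vtil n := by
  set x : Fin (n + 1) → ℝ := fun i => v (Sum.inl i)
  set y : Fin (n + 1) → ℝ := fun i => v (Sum.inr i)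
  have hv : v = Sum.elim x y := by ext (i | i) <;> rfl
  have hx : x ≠ 0 := fun h => hF fun i => congrFun h i
  have hy : y ≠ 0 := fun h => hE fun i => congrFun h i
  have hxy : x ⬝ᵥ y = 0 := by
    rw [hform, Jmat, hv, Matrix.fromBlocks_mulVec, sumElim_dotProduct_sumElim] at hnull
    simp [dotProduct_comm y x] at hnull
    linarith
  obtain ⟨A, hA, hAx, hAy⟩ := exists_det_one_mulVec_single hn x y hx hy hxy
  have hu : IsUnit A.det := by simp [hA]
  refine ⟨A⁻¹, 1, by simp [Matrix.det_nonsing_inv, hA], one_pos, ?_⟩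
  have hgx : A⁻¹ *ᵥ x = Pi.single 0 1 := by
    rw [← hAx, Matrix.mulVec_mulVec, Matrix.nonsing_inv_mul _ hu, Matrix.one_mulVec]
  rw [Memb, hv, Matrix.fromBlocks_mulVec, Matrix.nonsing_inv_nonsing_inv _ hu, one_smul]
  simp only [Sum.elim_comp_inl, Sum.elim_comp_inr, Matrix.zero_mulVec, add_zero, zero_add,
    hgx, hAy]
  ext (i | i) <;> simp [vtil, Pi.single_apply]
end
end

section
/- Orbit classification on null rays (Section 3.3): for any two nonzero vectors u, v ∈ ℝ^{2n+2} with h(u,u) = 0 = h(v,v), there exist g ∈ SL(n+1,ℝ) and t > 0 with M(g)·u = t·v if and only if (u ∈ E ⟺ v ∈ E) and (u ∈ F ⟺ v ∈ F). In particular, the embedded SL(n+1,ℝ)-action on the set of null rays has exactly three orbits: the rays contained in E, the rays contained in F, and the rays contained in neither. -/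
open Matrix

noncomputable section

/-- A null vector pairs its `E`-part and its `F`-part to zero. -/
lemma hform_self_eq_zero_iff {n : ℕ} (u : Idx n → ℝ) :
    hform n u u = 0 ↔ (u ∘ Sum.inr) ⬝ᵥ (u ∘ Sum.inl) = 0 := by
  have h : hform n u u = 2 * ((u ∘ Sum.inr) ⬝ᵥ (u ∘ Sum.inl)) := by
    simp only [hform, Jmat, fromBlocks_mulVec, dotProduct, Fintype.sum_sum_type, Sum.elim_inl,
      Sum.elim_inr, zero_mulVec, one_mulVec, zero_add, add_zero, Function.comp_apply, two_mul]
    congr 1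
    exact Finset.sum_congr rfl fun _ _ => mul_comm _ _
  rw [h]
  simp

lemma mem_Eset_iff {n : ℕ} (u : Idx n → ℝ) : u ∈ Eset n ↔ u ∘ Sum.inr = 0 := by
  simp [Eset, funext_iff]

lemma mem_Fset_iff {n : ℕ} (u : Idx n → ℝ) : u ∈ Fset n ↔ u ∘ Sum.inl = 0 := by
  simp [Fset, funext_iff]

section

variable {ι : Type*} [Fintype ι]

/-- Two nonzero vectors admit a functional that is `1` on the first and nonzero on the second. -/
lemma exists_dotProduct_eq_one_and_ne_zero {x y : ι → ℝ} (hx : x ≠ 0) (hy : y ≠ 0) :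
    ∃ c : ι → ℝ, c ⬝ᵥ x = 1 ∧ c ⬝ᵥ y ≠ 0 := by
  have hxx : x ⬝ᵥ x ≠ 0 := by simpa using hx
  have hyy : y ⬝ᵥ y ≠ 0 := by simpa using hy
  obtain ⟨c, hcx, hcy⟩ : ∃ c : ι → ℝ, c ⬝ᵥ x ≠ 0 ∧ c ⬝ᵥ y ≠ 0 := by
    by_cases h : x ⬝ᵥ y = 0
    · refine ⟨x + y, ?_, ?_⟩
      · rwa [add_dotProduct, dotProduct_comm y x, h, add_zero]
      · rwa [add_dotProduct, h, zero_add]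
    · exact ⟨x, hxx, h⟩
  refine ⟨(c ⬝ᵥ x)⁻¹ • c, ?_, ?_⟩
  · rw [smul_dotProduct, smul_eq_mul, inv_mul_cancel₀ hcx]
  · rw [smul_dotProduct, smul_eq_mul]
    exact mul_ne_zero (inv_ne_zero hcx) hcy

lemma exists_ne_zero_orthogonal_pair (hι : 2 < Fintype.card ι) (x y : ι → ℝ) :
    ∃ b : ι → ℝ, b ≠ 0 ∧ b ⬝ᵥ x = 0 ∧ b ⬝ᵥ y = 0 := by
  have hker : LinearMap.ker (Matrix.mulVecLin (Matrix.of ![x, y])) ≠ ⊥ := by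
    apply LinearMap.ker_ne_bot_of_finrank_lt
    simpa using hι
  obtain ⟨b, hb, hb0⟩ := Submodule.exists_mem_ne_zero_of_ne_bot hker
  have hb' := LinearMap.mem_ker.1 hb
  refine ⟨b, hb0, ?_, ?_⟩
  · rw [dotProduct_comm]
    exact congrFun hb' 0
  · rw [dotProduct_comm]
    exact congrFun hb' 1

variable [DecidableEq ι]

/-- The determinant of a rank-one perturbation of the identity. -/
lemma det_one_add_vecMulVec_eq (a b : ι → ℝ) : (1 + vecMulVec a b).det = 1 + b ⬝ᵥ a := by
  rw [vecMulVec_eq Unit, det_one_add_replicateCol_mul_replicateRow]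

lemma one_add_vecMulVec_mulVec (a b x : ι → ℝ) :
    (1 + vecMulVec a b) *ᵥ x = x + (b ⬝ᵥ x) • a := by
  rw [add_mulVec, one_mulVec, vecMulVec_mulVec, op_smul_eq_smul]

lemma transpose_one_add_vecMulVec_mulVec (a b x : ι → ℝ) :
    (1 + vecMulVec a b)ᵀ *ᵥ x = x + (a ⬝ᵥ x) • b := by
  rw [transpose_add, transpose_one, transpose_vecMulVec, one_add_vecMulVec_mulVec]

/-- The general linear group acts transitively on nonzero vectors. -/
lemma exists_det_ne_zero_mulVec_eq {x y : ι → ℝ} (hx : x ≠ 0) (hy : y ≠ 0) :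
    ∃ g : Matrix ι ι ℝ, g.det ≠ 0 ∧ g *ᵥ x = y := by
  obtain ⟨c, hcx, hcy⟩ := exists_dotProduct_eq_one_and_ne_zero hx hy
  refine ⟨1 + vecMulVec (y - x) c, ?_, ?_⟩
  · rw [det_one_add_vecMulVec_eq, dotProduct_sub, hcx]
    simpa using hcy
  · rw [one_add_vecMulVec_mulVec, hcx]
    simp

/-- The stabilizer of a vector acts transitively on the nonzero functionals annihilating it. -/
lemma exists_stabilizer_transpose_mulVec_eq {y ξ η : ι → ℝ} (hξ : ξ ≠ 0) (hη : η ≠ 0)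
    (hξy : ξ ⬝ᵥ y = 0) (hηy : η ⬝ᵥ y = 0) :
    ∃ g : Matrix ι ι ℝ, g.det ≠ 0 ∧ g *ᵥ y = y ∧ gᵀ *ᵥ η = ξ := by
  obtain ⟨z, hzη, hzξ⟩ := exists_dotProduct_eq_one_and_ne_zero hη hξ
  refine ⟨1 + vecMulVec z (ξ - η), ?_, ?_, ?_⟩
  · rw [det_one_add_vecMulVec_eq, dotProduct_comm, dotProduct_sub, hzη]
    simpa using hzξ
  · rw [one_add_vecMulVec_mulVec, sub_dotProduct, hξy, hηy]
    simp
  · rw [transpose_one_add_vecMulVec_mulVec, hzη]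
    simp

/-- In dimension at least three, the stabilizer of a vector and a functional contains matrices of
every determinant. -/
lemma exists_stabilizer_det_eq (hι : 2 < Fintype.card ι) (y η : ι → ℝ) (d : ℝ) :
    ∃ g : Matrix ι ι ℝ, g.det = d ∧ g *ᵥ y = y ∧ gᵀ *ᵥ η = η := by
  obtain ⟨b, hb, hby, hbη⟩ := exists_ne_zero_orthogonal_pair hι y η
  have hbb : b ⬝ᵥ b ≠ 0 := by simpa using hb
  refine ⟨1 + vecMulVec (((d - 1) / (b ⬝ᵥ b)) • b) b, ?_, ?_, ?_⟩
  · rw [det_one_add_vecMulVec_eq, dotProduct_smul, smul_eq_mul, div_mul_cancel₀ _ hbb]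
    ring
  · rw [one_add_vecMulVec_mulVec, hby]
    simp
  · rw [transpose_one_add_vecMulVec_mulVec, smul_dotProduct, hbη]
    simp

/-- In dimension at least three, the special linear group acts transitively on pairs of a nonzero
vector and a nonzero functional annihilating it. -/
lemma exists_det_eq_one_mulVec_eq_transpose_mulVec_eq (hι : 2 < Fintype.card ι)
    {x y ξ η : ι → ℝ} (hx : x ≠ 0) (hy : y ≠ 0) (hξ : ξ ≠ 0) (hη : η ≠ 0)
    (hξx : ξ ⬝ᵥ x = 0) (hηy : η ⬝ᵥ y = 0) :
    ∃ g : Matrix ι ι ℝ, g.det = 1 ∧ g *ᵥ x = y ∧ gᵀ *ᵥ η = ξ := by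
  obtain ⟨g₁, hd₁, hg₁⟩ := exists_det_ne_zero_mulVec_eq hx hy
  have hunit : IsUnit g₁ᵀ.det := by simpa [det_transpose] using hd₁
  obtain ⟨ζ, hζ⟩ : ∃ ζ, g₁ᵀ *ᵥ ζ = ξ :=
    ⟨g₁ᵀ⁻¹ *ᵥ ξ, by rw [mulVec_mulVec, mul_nonsing_inv _ hunit, one_mulVec]⟩
  have hζ0 : ζ ≠ 0 := by
    rintro rfl
    exact hξ (by rw [← hζ, mulVec_zero])
  have hζy : ζ ⬝ᵥ y = 0 := by
    rw [← hg₁, dotProduct_mulVec, ← mulVec_transpose, hζ, hξx]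
  obtain ⟨g₂, hd₂, hg₂, hg₂'⟩ := exists_stabilizer_transpose_mulVec_eq hζ0 hη hζy hηy
  obtain ⟨g₃, hd₃, hg₃, hg₃'⟩ := exists_stabilizer_det_eq hι y η (g₂.det * g₁.det)⁻¹
  refine ⟨g₃ * (g₂ * g₁), ?_, ?_, ?_⟩
  · rw [det_mul, det_mul, hd₃, inv_mul_cancel₀ (mul_ne_zero hd₂ hd₁)]
  · rw [← mulVec_mulVec, ← mulVec_mulVec, hg₁, hg₂, hg₃]
  · rw [transpose_mul, transpose_mul, ← mulVec_mulVec, ← mulVec_mulVec, hg₃', hg₂', hζ]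

/-- In dimension at least three, the special linear group acts transitively on the pairs of a
vector and a functional annihilating it, not both zero, with prescribed vanishing components. -/
lemma exists_det_eq_one_of_eq_zero_iff (hι : 2 < Fintype.card ι) {x y ξ η : ι → ℝ}
    (hxξ : x ≠ 0 ∨ ξ ≠ 0) (hxy : x = 0 ↔ y = 0) (hξη : ξ = 0 ↔ η = 0)
    (hξx : ξ ⬝ᵥ x = 0) (hηy : η ⬝ᵥ y = 0) :
    ∃ g : Matrix ι ι ℝ, g.det = 1 ∧ g *ᵥ x = y ∧ gᵀ *ᵥ η = ξ := by
  by_cases hx : x = 0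
  · have hξ := hxξ.resolve_left (not_not.2 hx)
    obtain ⟨a, ha, haξ, -⟩ := exists_ne_zero_orthogonal_pair hι ξ ξ
    obtain ⟨b, hb, hbη, -⟩ := exists_ne_zero_orthogonal_pair hι η η
    obtain ⟨g, hd, -, hg⟩ := exists_det_eq_one_mulVec_eq_transpose_mulVec_eq hι ha hb hξ
      (mt hξη.2 hξ) (dotProduct_comm ξ a ▸ haξ) (dotProduct_comm η b ▸ hbη)
    exact ⟨g, hd, by rw [hx, hxy.1 hx, mulVec_zero], hg⟩
  by_cases hξ : ξ = 0
  · obtain ⟨a, ha, hax, -⟩ := exists_ne_zero_orthogonal_pair hι x x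
    obtain ⟨b, hb, hby, -⟩ := exists_ne_zero_orthogonal_pair hι y y
    obtain ⟨g, hd, hg, -⟩ := exists_det_eq_one_mulVec_eq_transpose_mulVec_eq hι hx
      (mt hxy.2 hx) ha hb hax hby
    exact ⟨g, hd, hg, by rw [hξ, hξη.1 hξ, mulVec_zero]⟩
  exact exists_det_eq_one_mulVec_eq_transpose_mulVec_eq hι hx (mt hxy.2 hx) hξ (mt hξη.2 hξ)
    hξx hηy

end

/-- The embedded action, read on the `E`-part and the `F`-part. -/
lemma Memb_mulVec_eq_iff {n : ℕ} {g : Matrix (Fin (n + 1)) (Fin (n + 1)) ℝ} (hg : g.det = 1)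
    (u w : Idx n → ℝ) :
    Memb g *ᵥ u = w ↔
      g *ᵥ (u ∘ Sum.inl) = w ∘ Sum.inl ∧ gᵀ *ᵥ (w ∘ Sum.inr) = u ∘ Sum.inr := by
  have hunit : IsUnit gᵀ.det := by simp [hg]
  have hinr : (g⁻¹)ᵀ *ᵥ (u ∘ Sum.inr) = w ∘ Sum.inr ↔ gᵀ *ᵥ (w ∘ Sum.inr) = u ∘ Sum.inr := by
    rw [transpose_nonsing_inv]
    constructor <;> intro h <;> rw [← h, mulVec_mulVec]
    · rw [mul_nonsing_inv _ hunit, one_mulVec]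
    · rw [nonsing_inv_mul _ hunit, one_mulVec]
  rw [Memb, fromBlocks_mulVec, zero_mulVec, zero_mulVec, add_zero, zero_add, ← hinr]
  constructor
  · rintro rfl
    exact ⟨rfl, rfl⟩
  · rintro ⟨h₁, h₂⟩
    rw [h₁, h₂, Sum.elim_comp_inl_inr]

/-- orbit classification on null rays: for nonzero null vectors `u, v`,
the ray of `u` can be mapped to the ray of `v` by the embedded `SL(n+1,ℝ)`-action if and
only if `(u ∈ E ⟺ v ∈ E)` and `(u ∈ F ⟺ v ∈ F)`. -/
theorem stmt8 (n : ℕ) (hn : 2 ≤ n) (u v : Idx n → ℝ) (hu : u ≠ 0) (hv : v ≠ 0)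
    (hnu : hform n u u = 0) (hnv : hform n v v = 0) :
    (∃ (g : Matrix (Fin (n + 1)) (Fin (n + 1)) ℝ) (t : ℝ),
        g.det = 1 ∧ 0 < t ∧ (Memb g).mulVec u = t • v) ↔
      ((u ∈ Eset n ↔ v ∈ Eset n) ∧ (u ∈ Fset n ↔ v ∈ Fset n)) := by
  rw [hform_self_eq_zero_iff] at hnu hnv
  simp only [mem_Eset_iff, mem_Fset_iff]
  constructor
  · rintro ⟨g, t, hd, ht, h⟩
    rw [Memb_mulVec_eq_iff hd] at h
    obtain ⟨hE, hF⟩ := h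
    have hinj : ∀ (A : Matrix (Fin (n + 1)) (Fin (n + 1)) ℝ), A.det = 1 →
        ∀ x, A *ᵥ x = 0 ↔ x = 0 := fun A hA x =>
      ⟨eq_zero_of_mulVec_eq_zero (by simp [hA]), fun hx => by rw [hx, mulVec_zero]⟩
    have hsmul : ∀ x : Fin (n + 1) → ℝ, t • x = 0 ↔ x = 0 := fun x => by simp [ht.ne']
    constructor
    · rw [← hF, hinj _ (by rw [det_transpose, hd])]
      exact hsmul _
    · rw [← hinj g hd, hE]
      exact hsmul _
  · rintro ⟨hE, hF⟩
    have hne : u ∘ Sum.inl ≠ 0 ∨ u ∘ Sum.inr ≠ 0 := by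
      by_contra! h
      exact hu (funext (Sum.rec (congrFun h.1) (congrFun h.2)))
    obtain ⟨g, hd, hg, hg'⟩ := exists_det_eq_one_of_eq_zero_iff
      (by rw [Fintype.card_fin]; omega) hne hF hE hnu hnv
    refine ⟨g, 1, hd, one_pos, ?_⟩
    rw [one_smul, Memb_mulVec_eq_iff hd]
    exact ⟨hg, hg'⟩
end
end

section
/- The bracket relations of eq. (3.13) hold: [p̃₊, Λ²F̄] = f̂ (the set of brackets [Z,A] with Z ∈ p̃₊ and A ∈ Λ²F̄ spans exactly the subspace f̂, and each such bracket lies in f̂), and [f̂, Λ²F̄] = 0 (every element of f̂ commutes with every element of Λ²F̄). -/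
open Matrix

noncomputable section

/-- The nilradical `p̃₊ = {X ∈ so(n+1,n+1) : Xṽ = 0 and X(ṽ^⊥) ⊆ ℝṽ}`. -/
def ptilplus (n : ℕ) : Set (Matrix (Idx n) (Idx n) ℝ) :=
  {X ∈ soSplit n | X.mulVec (vtil n) = 0 ∧
    ∀ u : Idx n → ℝ, hform n u (vtil n) = 0 → ∃ c : ℝ, X.mulVec u = c • vtil n}

/-- `Λ²F̄ = {[[0,0],[C,0]] : Cᵀ = −C, Ce₁ = 0}`. -/
def Lam2Fbar (n : ℕ) : Set (Matrix (Idx n) (Idx n) ℝ) :=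
  {X | ∃ C : Matrix (Fin (n + 1)) (Fin (n + 1)) ℝ,
      Cᵀ = -C ∧ C.mulVec (Pi.single 0 1) = 0 ∧ X = Matrix.fromBlocks 0 0 C 0}

/-- `f̂ = {X ∈ p̃₊ : the top-right (n+1)×(n+1) block of X is zero}`. -/
def fhat (n : ℕ) : Set (Matrix (Idx n) (Idx n) ℝ) :=
  {X ∈ ptilplus n | ∀ i j : Fin (n + 1), X (Sum.inl i) (Sum.inr j) = 0}

theorem Jmat_mulVec (n : ℕ) (x : Idx n → ℝ) :
    (Jmat n).mulVec x = Sum.elim (x ∘ Sum.inr) (x ∘ Sum.inl) := by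
  simp [Jmat, fromBlocks_mulVec]

theorem Jmat_transpose (n : ℕ) : (Jmat n)ᵀ = Jmat n := by
  simp [Jmat, fromBlocks_transpose]

theorem hform_comm (n : ℕ) (x y : Idx n → ℝ) : hform n x y = hform n y x := by
  rw [hform, hform, dotProduct_mulVec, ← mulVec_transpose, Jmat_transpose, dotProduct_comm]

theorem hform_mulVec_left {n : ℕ} {X : Matrix (Idx n) (Idx n) ℝ} (hX : X ∈ soSplit n)
    (x y : Idx n → ℝ) : hform n (X.mulVec x) y = -hform n x (X.mulVec y) := by
  have h : Xᵀ * Jmat n = -(Jmat n * X) := eq_neg_of_add_eq_zero_left hX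
  rw [hform, hform, dotProduct_comm, dotProduct_mulVec, ← mulVec_transpose, mulVec_mulVec, h,
    neg_mulVec, neg_dotProduct, dotProduct_comm, mulVec_mulVec]

theorem hform_vtil (n : ℕ) (x : Idx n → ℝ) :
    hform n x (vtil n) = x (Sum.inl (Fin.last n)) + x (Sum.inr 0) := by
  rw [hform, vtil, mulVec_add, dotProduct_add, Jmat_mulVec, Jmat_mulVec]
  simp [dotProduct, Pi.single_apply, add_comm]

theorem hform_vtil_self {n : ℕ} (hn : 2 ≤ n) : hform n (vtil n) (vtil n) = 0 := by
  have h0 : Fin.last n ≠ 0 := by simp [Fin.ext_iff]; omega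
  rw [hform_vtil]
  simp [vtil, h0, h0.symm]

/-- The endomorphism `u ↦ h(ṽ,u) w - h(w,u) ṽ`, as a linear function of `w`. -/
def wedgeVtil (n : ℕ) : (Idx n → ℝ) →ₗ[ℝ] Matrix (Idx n) (Idx n) ℝ where
  toFun w := vecMulVec w ((Jmat n).mulVec (vtil n)) - vecMulVec (vtil n) ((Jmat n).mulVec w)
  map_add' x y := by
    rw [add_vecMulVec, mulVec_add, vecMulVec_add]
    abel
  map_smul' c x := by
    rw [smul_vecMulVec, mulVec_smul, vecMulVec_smul, RingHom.id_apply, smul_sub]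

theorem wedgeVtil_apply (n : ℕ) (w : Idx n → ℝ) : wedgeVtil n w =
    vecMulVec w ((Jmat n).mulVec (vtil n)) - vecMulVec (vtil n) ((Jmat n).mulVec w) := rfl

theorem wedgeVtil_mulVec (n : ℕ) (w u : Idx n → ℝ) :
    (wedgeVtil n w).mulVec u = hform n u (vtil n) • w - hform n u w • vtil n := by
  rw [wedgeVtil_apply, sub_mulVec, vecMulVec_mulVec, vecMulVec_mulVec, hform, hform,
    op_smul_eq_smul, op_smul_eq_smul, dotProduct_comm _ u, dotProduct_comm _ u]

theorem wedgeVtil_vtil (n : ℕ) : wedgeVtil n (vtil n) = 0 := by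
  rw [wedgeVtil_apply, sub_self]

theorem wedgeVtil_mem_soSplit (n : ℕ) (w : Idx n → ℝ) : wedgeVtil n w ∈ soSplit n := by
  change (wedgeVtil n w)ᵀ * Jmat n + Jmat n * wedgeVtil n w = 0
  rw [wedgeVtil_apply, transpose_sub, transpose_vecMulVec, transpose_vecMulVec, sub_mul, mul_sub,
    vecMulVec_mul, vecMulVec_mul, mul_vecMulVec, mul_vecMulVec, ← mulVec_transpose,
    ← mulVec_transpose, Jmat_transpose]
  abel

theorem wedgeVtil_mem_ptilplus {n : ℕ} (hn : 2 ≤ n) {w : Idx n → ℝ}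
    (hw : hform n w (vtil n) = 0) : wedgeVtil n w ∈ ptilplus n := by
  refine ⟨wedgeVtil_mem_soSplit n w, ?_, fun u hu => ⟨-hform n u w, ?_⟩⟩
  · rw [wedgeVtil_mulVec, hform_vtil_self hn, hform_comm, hw, zero_smul, zero_smul, sub_self]
  · rw [wedgeVtil_mulVec, hu, zero_smul, zero_sub, neg_smul]

theorem exists_eq_wedgeVtil {n : ℕ} {X : Matrix (Idx n) (Idx n) ℝ} (hX : X ∈ ptilplus n) :
    ∃ w, hform n w (vtil n) = 0 ∧ X = wedgeVtil n w := by
  obtain ⟨hso, hv, hperp⟩ := hX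
  set v' : Idx n → ℝ := Pi.single (Sum.inr 0) 1 with hv'
  have hv'v : hform n v' (vtil n) = 1 := by simp [hform_vtil, hv']
  have hself : hform n v' (X.mulVec v') = 0 := by
    have := hform_mulVec_left hso v' v'
    rw [hform_comm] at this
    linarith
  refine ⟨X.mulVec v', ?_, ?_⟩
  · rw [hform_mulVec_left hso, hv]
    simp [hform]
  refine Matrix.ext_of_mulVec_single fun j => ?_
  generalize (Pi.single j 1 : Idx n → ℝ) = u
  set s := hform n u (vtil n) with hs
  have hu₀ : hform n (u - s • v') (vtil n) = 0 := by
    have : hform n (u - s • v') (vtil n) = hform n u (vtil n) - s * hform n v' (vtil n) := by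
      simp [hform, sub_dotProduct, smul_dotProduct]
    rw [this, hv'v, ← hs, mul_one, sub_self]
  obtain ⟨c, hc⟩ := hperp _ hu₀
  have hcval : c = -hform n u (X.mulVec v') := by
    have h := hform_mulVec_left hso (u - s • v') v'
    rw [hc] at h
    have h1 : hform n (c • vtil n) v' = c * hform n v' (vtil n) := by
      rw [hform_comm n v']
      simp [hform, smul_dotProduct]
    have h2 : hform n (u - s • v') (X.mulVec v')
        = hform n u (X.mulVec v') - s * hform n v' (X.mulVec v') := by
      simp [hform, sub_dotProduct, smul_dotProduct]
    rw [h1, h2, hv'v, hself] at h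
    linarith
  rw [wedgeVtil_mulVec, ← hs, sub_eq_add_neg, ← neg_smul, ← hcval, ← hc, mulVec_sub, mulVec_smul]
  abel

theorem Lam2Fbar_subset_soSplit (n : ℕ) : Lam2Fbar n ⊆ soSplit n := by
  rintro _ ⟨C, hC, -, rfl⟩
  simp [soSplit, Jmat, fromBlocks_transpose, fromBlocks_multiply, fromBlocks_add, hC]

theorem mulVec_vtil_of_mem_Lam2Fbar {n : ℕ} {A : Matrix (Idx n) (Idx n) ℝ}
    (hA : A ∈ Lam2Fbar n) : A.mulVec (vtil n) = 0 := by
  obtain ⟨C, -, hCe, rfl⟩ := hA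
  have : vtil n ∘ Sum.inl = Pi.single 0 1 := by
    ext i
    simp [vtil, Pi.single_apply]
  rw [fromBlocks_mulVec, this, hCe]
  ext (i | i) <;> simp

/-- An element of `so(n+1,n+1)` that kills `ṽ` acts on `ṽ ∧ w` through its action on `w`. -/
theorem bracket_wedgeVtil {n : ℕ} {A : Matrix (Idx n) (Idx n) ℝ} (hso : A ∈ soSplit n)
    (hv : A.mulVec (vtil n) = 0) (w : Idx n → ℝ) :
    wedgeVtil n w * A - A * wedgeVtil n w = wedgeVtil n (-A.mulVec w) := by
  refine Matrix.ext_of_mulVec_single fun j => ?_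
  generalize (Pi.single j 1 : Idx n → ℝ) = u
  have h1 := hform_mulVec_left hso u (vtil n)
  have h2 := hform_mulVec_left hso u w
  have h3 : hform n u (-A.mulVec w) = -hform n u (A.mulVec w) := by
    simp [hform, mulVec_neg]
  have h4 : hform n u 0 = 0 := by simp [hform]
  rw [hv, h4, neg_zero] at h1
  rw [sub_mulVec, ← mulVec_mulVec, ← mulVec_mulVec, wedgeVtil_mulVec, wedgeVtil_mulVec,
    wedgeVtil_mulVec, h1, h2, h3, mulVec_sub, mulVec_smul, mulVec_smul, hv]
  simp only [zero_smul, neg_smul, smul_neg, smul_zero, sub_zero, sub_neg_eq_add]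
  abel

/-- The inclusion of `F̄`, the span of the last `n+1` basis vectors. -/
def inrEmb (n : ℕ) : (Fin (n + 1) → ℝ) →ₗ[ℝ] (Idx n → ℝ) where
  toFun q := Sum.elim 0 q
  map_add' x y := by ext (i | i) <;> simp
  map_smul' c x := by ext (i | i) <;> simp

theorem inrEmb_apply (n : ℕ) (q : Fin (n + 1) → ℝ) : inrEmb n q = Sum.elim (0 : Fin (n + 1) → ℝ) q := rfl

theorem wedgeVtil_inl_inr (n : ℕ) (w : Idx n → ℝ) (i j : Fin (n + 1)) :
    wedgeVtil n w (Sum.inl i) (Sum.inr j) =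
      w (Sum.inl i) * (Pi.single 0 1 : Fin (n + 1) → ℝ) j
        - (Pi.single 0 1 : Fin (n + 1) → ℝ) i * w (Sum.inl j) := by
  simp [wedgeVtil_apply, vecMulVec_apply, Jmat_mulVec, vtil, Pi.single_apply]

theorem mem_fhat_iff {n : ℕ} (hn : 2 ≤ n) {X : Matrix (Idx n) (Idx n) ℝ} :
    X ∈ fhat n ↔ ∃ q : Fin (n + 1) → ℝ, q 0 = 0 ∧ wedgeVtil n (inrEmb n q) = X := by
  constructor
  · rintro ⟨hX, hblock⟩
    obtain ⟨w, hw, rfl⟩ := exists_eq_wedgeVtil hX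
    have h0 : Fin.last n ≠ 0 := by simp [Fin.ext_iff]; omega
    have hinl : ∀ i, i ≠ 0 → w (Sum.inl i) = 0 := fun i hi => by
      simpa [wedgeVtil_inl_inr, hi] using hblock i 0
    have hw' : w = w (Sum.inl 0) • vtil n
        + inrEmb n (fun i => w (Sum.inr i) - w (Sum.inl 0) * vtil n (Sum.inr i)) := by
      ext (i | i)
      · by_cases hi : i = 0
        · subst hi
          simp [inrEmb_apply, vtil]
        · simp [inrEmb_apply, vtil, hi, hinl i hi]
      · simp [inrEmb_apply]
    refine ⟨fun i => w (Sum.inr i) - w (Sum.inl 0) * vtil n (Sum.inr i), ?_, ?_⟩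
    · rw [hform_vtil, hinl _ h0, zero_add] at hw
      simp [hw, vtil, h0.symm]
    · conv_rhs => rw [hw', map_add, map_smul, wedgeVtil_vtil, smul_zero, zero_add]
  · rintro ⟨q, hq, rfl⟩
    refine ⟨wedgeVtil_mem_ptilplus hn ?_, fun i j => ?_⟩
    · simp [hform_vtil, inrEmb_apply, hq]
    · simp [wedgeVtil_inl_inr, inrEmb_apply]

theorem fromBlocks_mulVec_eq_inrEmb (n : ℕ) (C : Matrix (Fin (n + 1)) (Fin (n + 1)) ℝ)
    (w : Idx n → ℝ) :
    (fromBlocks 0 0 C 0).mulVec w = inrEmb n (C.mulVec (w ∘ Sum.inl)) := by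
  rw [fromBlocks_mulVec, inrEmb_apply]
  simp

theorem bracket_mem_fhat {n : ℕ} (hn : 2 ≤ n) {Z A : Matrix (Idx n) (Idx n) ℝ}
    (hZ : Z ∈ ptilplus n) (hA : A ∈ Lam2Fbar n) : Z * A - A * Z ∈ fhat n := by
  obtain ⟨w, -, rfl⟩ := exists_eq_wedgeVtil hZ
  rw [bracket_wedgeVtil (Lam2Fbar_subset_soSplit n hA) (mulVec_vtil_of_mem_Lam2Fbar hA),
    mem_fhat_iff hn]
  obtain ⟨C, hC, hCe, rfl⟩ := hA
  refine ⟨-C.mulVec (w ∘ Sum.inl), ?_, by rw [fromBlocks_mulVec_eq_inrEmb, map_neg (inrEmb n)]⟩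
  have hrow : ∀ j, C 0 j = 0 := fun j => by
    have h1 : C j 0 = 0 := by simpa using congrFun hCe j
    have h2 : C j 0 = -C 0 j := congrFun (congrFun hC 0) j
    linarith
  simp [mulVec, dotProduct, hrow]

theorem bracket_eq_zero_of_mem_fhat {n : ℕ} (hn : 2 ≤ n) {X A : Matrix (Idx n) (Idx n) ℝ}
    (hX : X ∈ fhat n) (hA : A ∈ Lam2Fbar n) : X * A - A * X = 0 := by
  obtain ⟨q, -, rfl⟩ := (mem_fhat_iff hn).1 hX
  rw [bracket_wedgeVtil (Lam2Fbar_subset_soSplit n hA) (mulVec_vtil_of_mem_Lam2Fbar hA)]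
  obtain ⟨C, -, -, rfl⟩ := hA
  have : inrEmb n q ∘ Sum.inl = 0 := rfl
  rw [fromBlocks_mulVec_eq_inrEmb, this, mulVec_zero, map_zero, neg_zero, map_zero]

theorem exists_bracket_eq_wedgeVtil_single {n : ℕ} (hn : 2 ≤ n) {i : Fin (n + 1)} (hi : i ≠ 0) :
    ∃ Z ∈ ptilplus n, ∃ A ∈ Lam2Fbar n,
      wedgeVtil n (inrEmb n (Pi.single i 1)) = Z * A - A * Z := by
  obtain ⟨j, hj0, hji⟩ : ∃ j : Fin (n + 1), j ≠ 0 ∧ j ≠ i := by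
    by_cases h : i = ⟨1, by omega⟩
    · exact ⟨⟨2, by omega⟩, by simp [Fin.ext_iff], by simp [h]⟩
    · exact ⟨⟨1, by omega⟩, by simp [Fin.ext_iff], Ne.symm h⟩
  let C : Matrix (Fin (n + 1)) (Fin (n + 1)) ℝ := single j i 1 - single i j 1
  let w : Idx n → ℝ := Sum.elim (Pi.single j 1)
    (Pi.single 0 (-(Pi.single j 1 : Fin (n + 1) → ℝ) (Fin.last n)))
  have hA : fromBlocks 0 0 C 0 ∈ Lam2Fbar n := by
    refine ⟨C, by simp [C], ?_, rfl⟩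
    ext k
    simp [C, hi, hj0]
  refine ⟨wedgeVtil n w, wedgeVtil_mem_ptilplus hn (by simp [hform_vtil, w]), _, hA, ?_⟩
  have hCw : C.mulVec (w ∘ Sum.inl) = -Pi.single i 1 := by
    ext k
    simp [C, w, single_apply, hji.symm, Pi.single_apply, eq_comm]
  rw [bracket_wedgeVtil (Lam2Fbar_subset_soSplit n hA) (mulVec_vtil_of_mem_Lam2Fbar hA),
    fromBlocks_mulVec_eq_inrEmb, hCw, map_neg (inrEmb n), neg_neg]

/-- the bracket relations of eq. (3.13): each bracket `[Z,A]` with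
`Z ∈ p̃₊`, `A ∈ Λ²F̄` lies in `f̂`, these brackets span exactly `f̂`, and `[f̂, Λ²F̄] = 0`. -/
theorem stmt10 (n : ℕ) (hn : 2 ≤ n) :
    (∀ Z ∈ ptilplus n, ∀ A ∈ Lam2Fbar n, Z * A - A * Z ∈ fhat n) ∧
    ((Submodule.span ℝ
        {X : Matrix (Idx n) (Idx n) ℝ |
          ∃ Z ∈ ptilplus n, ∃ A ∈ Lam2Fbar n, X = Z * A - A * Z} : Set _)
      = fhat n) ∧
    (∀ X ∈ fhat n, ∀ A ∈ Lam2Fbar n, X * A - A * X = 0) := by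
  refine ⟨fun Z hZ A hA => bracket_mem_fhat hn hZ hA, ?_,
    fun X hX A hA => bracket_eq_zero_of_mem_fhat hn hX hA⟩
  apply Set.Subset.antisymm
  · let S : Submodule ℝ (Matrix (Idx n) (Idx n) ℝ) :=
      (LinearMap.ker (LinearMap.proj (R := ℝ) (φ := fun _ : Fin (n + 1) => ℝ) 0)).map
        (wedgeVtil n ∘ₗ inrEmb n)
    have hS : (S : Set (Matrix (Idx n) (Idx n) ℝ)) = fhat n := by
      ext X
      rw [mem_fhat_iff hn]
      rfl
    rw [← hS, SetLike.coe_subset_coe, Submodule.span_le, hS]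
    rintro _ ⟨Z, hZ, A, hA, rfl⟩
    exact bracket_mem_fhat hn hZ hA
  · intro X hX
    obtain ⟨q, hq, rfl⟩ := (mem_fhat_iff hn).1 hX
    rw [pi_eq_sum_univ' q, map_sum, map_sum]
    refine Submodule.sum_mem _ fun i _ => ?_
    rw [map_smul, map_smul]
    by_cases hi : i = 0
    · rw [hi, hq, zero_smul]
      exact Submodule.zero_mem _
    · exact Submodule.smul_mem _ _
        (Submodule.subset_span (exists_bracket_eq_wedgeVtil_single hn hi))
end
end

section
/- Block projections onto the projective data (eq. (3.12) of the paper): (i) the map sending X ∈ f̂ to its top-left (n+1)×(n+1) block is a linear isomorphism from f̂ onto p₊ := {e₁ξᵀ : ξ ∈ ℝ^{n+1}, ξ₁ = 0}; (ii) the set of top-left (n+1)×(n+1) blocks of those elements of p̃ that have the form [[A,0],[C,−Aᵀ]] with tr A = 0 and Cᵀ = −C equals p := {A ∈ sl(n+1,ℝ) : Ae₁ ∈ ℝe₁}. -/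
open Matrix

noncomputable section

/-- Top-left `(n+1)×(n+1)` block of a `(2n+2)×(2n+2)` matrix. -/
def topLeft {n : ℕ} (X : Matrix (Idx n) (Idx n) ℝ) : Matrix (Fin (n + 1)) (Fin (n + 1)) ℝ :=
  Matrix.of fun i j => X (Sum.inl i) (Sum.inl j)

/-- The projective nilradical `p₊ = {e₁ξᵀ : ξ ∈ ℝ^{n+1}, ξ₁ = 0}`. -/
def pplus (n : ℕ) : Set (Matrix (Fin (n + 1)) (Fin (n + 1)) ℝ) :=
  {Z | ∃ ξ : Fin (n + 1) → ℝ, ξ 0 = 0 ∧ Z = Matrix.vecMulVec (Pi.single 0 1) ξ}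

/-- The projective parabolic `p = {A ∈ sl(n+1,ℝ) : Ae₁ ∈ ℝe₁}`. -/
def pproj (n : ℕ) : Set (Matrix (Fin (n + 1)) (Fin (n + 1)) ℝ) :=
  {A | A.trace = 0 ∧ ∃ c : ℝ, A.mulVec (Pi.single 0 1) = c • (Pi.single 0 1 : Fin (n + 1) → ℝ)}

theorem mem_soSplit_fromBlocks {n : ℕ} (A B C D : Matrix (Fin (n + 1)) (Fin (n + 1)) ℝ) :
    (fromBlocks A B C D : Matrix (Idx n) (Idx n) ℝ) ∈ soSplit n ↔
      Bᵀ = -B ∧ Cᵀ = -C ∧ D = -Aᵀ := by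
  have key : (fromBlocks A B C D : Matrix (Idx n) (Idx n) ℝ) ∈ soSplit n ↔
      fromBlocks (Cᵀ + C) (Aᵀ + D) (Dᵀ + A) (Bᵀ + B) = fromBlocks 0 0 0 0 := by
    simp [soSplit, Jmat, fromBlocks_transpose, fromBlocks_multiply, fromBlocks_add]
  rw [key, fromBlocks_inj]
  simp only [add_eq_zero_iff_eq_neg]
  constructor
  · rintro ⟨hC, hA, -, hB⟩
    exact ⟨hB, hC, by rw [hA, neg_neg]⟩
  · rintro ⟨hB, hC, rfl⟩
    exact ⟨hC, by simp, by simp, hB⟩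

theorem vtil_eq_elim (n : ℕ) :
    vtil n = Sum.elim (Pi.single 0 1) (Pi.single (Fin.last n) 1) := by
  ext (i | i) <;> simp [vtil, Pi.single_apply]

theorem hform_elim_vtil {n : ℕ} (x y : Fin (n + 1) → ℝ) :
    hform n (Sum.elim x y) (vtil n) = x (Fin.last n) + y 0 := by
  simp [hform, Jmat, vtil_eq_elim, fromBlocks_mulVec, -mulVec_single]

theorem fromBlocks_mulVec_vtil {n : ℕ} (A B C D : Matrix (Fin (n + 1)) (Fin (n + 1)) ℝ) :
    fromBlocks A B C D *ᵥ vtil n =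
      Sum.elim (A.col 0 + B.col (Fin.last n)) (C.col 0 + D.col (Fin.last n)) := by
  simp [vtil_eq_elim, fromBlocks_mulVec]

theorem smul_vtil {n : ℕ} (c : ℝ) :
    c • vtil n = Sum.elim (Pi.single 0 c) (Pi.single (Fin.last n) c) := by
  ext (i | i) <;> simp [vtil, Pi.single_apply]

/-- The element of `f̂` whose top-left block is `e₁ξᵀ`. -/
def fhatElem (n : ℕ) (ξ : Fin (n + 1) → ℝ) : Matrix (Idx n) (Idx n) ℝ :=
  fromBlocks (vecMulVec (Pi.single 0 1) ξ) 0
    (vecMulVec (Pi.single (Fin.last n) 1) ξ - vecMulVec ξ (Pi.single (Fin.last n) 1))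
    (-(vecMulVec (Pi.single 0 1) ξ)ᵀ)

theorem topLeft_fhatElem {n : ℕ} (ξ : Fin (n + 1) → ℝ) :
    topLeft (fhatElem n ξ) = vecMulVec (Pi.single 0 1) ξ := rfl

theorem fhatElem_mulVec_elim {n : ℕ} (ξ x y : Fin (n + 1) → ℝ) :
    fhatElem n ξ *ᵥ Sum.elim x y =
      (ξ ⬝ᵥ x) • vtil n - Sum.elim (0 : Fin (n + 1) → ℝ) ((x (Fin.last n) + y 0) • ξ) := by
  ext (i | i)
  · simp [fhatElem, fromBlocks_mulVec, vecMulVec_mulVec, vtil_eq_elim]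
  · simp [fhatElem, fromBlocks_mulVec, vecMulVec_mulVec, sub_mulVec, neg_mulVec, vtil_eq_elim,
      transpose_vecMulVec]
    ring

theorem fhatElem_mem_fhat {n : ℕ} (hn : n ≠ 0) {ξ : Fin (n + 1) → ℝ} (hξ : ξ 0 = 0) :
    fhatElem n ξ ∈ fhat n := by
  refine ⟨⟨(mem_soSplit_fromBlocks _ _ _ _).2 ⟨by simp, ?_, rfl⟩, ?_, ?_⟩, fun i j => rfl⟩
  · simp [transpose_vecMulVec]
  · have h0 : (0 : Fin (n + 1)) ≠ Fin.last n := by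
      simpa [Fin.ext_iff] using hn.symm
    rw [vtil_eq_elim, fhatElem_mulVec_elim]
    ext (i | i) <;> simp [hξ, h0, h0.symm]
  · intro u hu
    rw [← Sum.elim_comp_inl_inr u] at hu ⊢
    rw [hform_elim_vtil] at hu
    refine ⟨ξ ⬝ᵥ (u ∘ Sum.inl), ?_⟩
    rw [fhatElem_mulVec_elim, hu]
    ext (i | i) <;> simp

theorem exists_eq_fhatElem {n : ℕ} {X : Matrix (Idx n) (Idx n) ℝ} (hX : X ∈ fhat n) :
    ∃ ξ : Fin (n + 1) → ℝ, ξ 0 = 0 ∧ X = fhatElem n ξ := by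
  obtain ⟨⟨hso, hv, hperp⟩, hB⟩ := hX
  obtain ⟨A, B, C, D, rfl⟩ : ∃ A B C D, X = fromBlocks A B C D :=
    ⟨_, _, _, _, (fromBlocks_toBlocks X).symm⟩
  obtain rfl : B = 0 := by ext i j; exact hB i j
  obtain ⟨-, hC, rfl⟩ := (mem_soSplit_fromBlocks _ _ _ _).1 hso
  rw [fromBlocks_mulVec_vtil] at hv
  have hrow : ∀ i j, i ≠ 0 → A i j = 0 := by
    intro i j hi
    obtain ⟨c, hc⟩ := hperp (Sum.elim 0 (Pi.single i 1)) (by rw [hform_elim_vtil]; simp [hi.symm])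
    rw [smul_vtil] at hc
    have h1 := congrFun hc (Sum.inl 0)
    have h2 := congrFun hc (Sum.inr j)
    simp at h1 h2
    subst h1
    simpa using h2
  have hcol : ∀ i j, j ≠ Fin.last n → C i j = if i = Fin.last n then A 0 j else 0 := by
    intro i j hj
    obtain ⟨c, hc⟩ := hperp (Sum.elim (Pi.single j 1) 0) (by rw [hform_elim_vtil]; simp [hj.symm])
    rw [smul_vtil] at hc
    have h1 := congrFun hc (Sum.inl 0)
    have h2 := congrFun hc (Sum.inr i)
    simp at h1 h2
    rw [h2, h1, Pi.single_apply]
  have hA : A = vecMulVec (Pi.single 0 1) (A 0) := by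
    ext i j
    by_cases hi : i = 0
    · simp [vecMulVec_apply, hi]
    · simp [vecMulVec_apply, hi, hrow i j hi]
  have hC' : C = vecMulVec (Pi.single (Fin.last n) 1) (A 0) -
      vecMulVec (A 0) (Pi.single (Fin.last n) 1) := by
    ext i j
    have hskew : C j i = -C i j := congrFun (congrFun hC i) j
    by_cases hj : j = Fin.last n
    · by_cases hi : i = Fin.last n
      · subst hi hj
        simp [vecMulVec_apply]
        linarith
      · have := hcol j i hi
        simp [vecMulVec_apply, hi, hj] at this hskew ⊢
        linarith
    · simp [vecMulVec_apply, hj, hcol i j hj, Pi.single_apply]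
  refine ⟨A 0, by simpa using congrFun hv (Sum.inl 0), ?_⟩
  rw [fhatElem, ← hA, ← hC']

theorem vecMulVec_single_one_injective {m : Type*} [DecidableEq m] (i : m) :
    Function.Injective (vecMulVec (Pi.single i 1 : m → ℝ) : (m → ℝ) → Matrix m m ℝ) := by
  intro ξ η h
  ext j
  simpa [vecMulVec_apply] using congrFun (congrFun h i) j

theorem exists_skew_col_eq {m : Type*} [DecidableEq m] (i : m) {w : m → ℝ}
    (hw : w i = 0) : ∃ C : Matrix m m ℝ, Cᵀ = -C ∧ C.col i = w := by
  refine ⟨vecMulVec w (Pi.single i 1) - vecMulVec (Pi.single i 1) w, ?_, ?_⟩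
  · simp [transpose_vecMulVec]
  · ext j
    simp [vecMulVec_apply, hw]

theorem fromBlocks_mem_ptil_iff {n : ℕ} (A C : Matrix (Fin (n + 1)) (Fin (n + 1)) ℝ)
    (hC : Cᵀ = -C) :
    (fromBlocks A 0 C (-Aᵀ) : Matrix (Idx n) (Idx n) ℝ) ∈ ptil n ↔
      ∃ c : ℝ, A.col 0 = Pi.single 0 c ∧
        C.col 0 = A.row (Fin.last n) + Pi.single (Fin.last n) c := by
  have hso : (fromBlocks A 0 C (-Aᵀ) : Matrix (Idx n) (Idx n) ℝ) ∈ soSplit n :=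
    (mem_soSplit_fromBlocks _ _ _ _).2 ⟨by simp, hC, rfl⟩
  simp only [ptil, Set.mem_ofPred_eq, hso, true_and, fromBlocks_mulVec_vtil, smul_vtil]
  refine exists_congr fun c => ?_
  rw [Sum.elim_eq_iff]
  refine and_congr ?_ ?_
  · simp [funext_iff]
  · simp only [funext_iff]
    refine forall_congr' fun i => ?_
    simp only [Pi.add_apply, col_apply, row_apply, Matrix.neg_apply, transpose_apply]
    constructor <;> intro h <;> linarith

/-- (i) the top-left block map is a linear isomorphism from `f̂` onto
`p₊`; (ii) the top-left blocks of the elements of `p̃` of the form `[[A,0],[C,−Aᵀ]]`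
with `tr A = 0` and `C` skew form exactly `p`. -/
theorem stmt11 (n : ℕ) (hn : 2 ≤ n) :
    (∀ (a b : ℝ) (X Y : Matrix (Idx n) (Idx n) ℝ),
        topLeft (a • X + b • Y) = a • topLeft X + b • topLeft Y) ∧
    (∀ X ∈ fhat n, ∀ Y ∈ fhat n, topLeft X = topLeft Y → X = Y) ∧
    (topLeft '' fhat n = pplus n) ∧
    ({A : Matrix (Fin (n + 1)) (Fin (n + 1)) ℝ |
        A.trace = 0 ∧ ∃ C : Matrix (Fin (n + 1)) (Fin (n + 1)) ℝ, Cᵀ = -C ∧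
          (Matrix.fromBlocks A 0 C (-Aᵀ) : Matrix (Idx n) (Idx n) ℝ) ∈ ptil n}
      = pproj n) := by
  have hn0 : n ≠ 0 := by omega
  refine ⟨fun a b X Y => rfl, ?_, ?_, ?_⟩
  · intro X hX Y hY h
    obtain ⟨ξ, -, rfl⟩ := exists_eq_fhatElem hX
    obtain ⟨η, -, rfl⟩ := exists_eq_fhatElem hY
    rw [vecMulVec_single_one_injective 0 h]
  · ext Z
    constructor
    · rintro ⟨X, hX, rfl⟩
      obtain ⟨ξ, hξ, rfl⟩ := exists_eq_fhatElem hX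
      exact ⟨ξ, hξ, topLeft_fhatElem ξ⟩
    · rintro ⟨ξ, hξ, rfl⟩
      exact ⟨fhatElem n ξ, fhatElem_mem_fhat hn0 hξ, topLeft_fhatElem ξ⟩
  · ext A
    have hsmul (c : ℝ) : c • (Pi.single 0 1 : Fin (n + 1) → ℝ) = Pi.single 0 c := by
      rw [← Pi.single_smul, smul_eq_mul, mul_one]
    simp only [pproj, Set.mem_ofPred_eq, mulVec_single_one, hsmul]
    refine and_congr_right fun _ => ⟨?_, ?_⟩
    · rintro ⟨C, hC, hmem⟩
      obtain ⟨c, hc, -⟩ := (fromBlocks_mem_ptil_iff A C hC).1 hmem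
      exact ⟨c, hc⟩
    · rintro ⟨c, hc⟩
      have hL : Fin.last n ≠ 0 := by simpa [Fin.ext_iff] using hn0
      have hAL : A (Fin.last n) 0 = 0 := by
        simpa [hL] using congrFun hc (Fin.last n)
      obtain ⟨C, hC, hcol⟩ := exists_skew_col_eq 0
        (w := A.row (Fin.last n) + Pi.single (Fin.last n) c) (by simp [hAL, hL.symm])
      exact ⟨C, hC, (fromBlocks_mem_ptil_iff A C hC).2 ⟨c, hc, hcol⟩⟩
end
end

section
/- If X ∈ f̂ and Z ∈ p₊ := {e₁ξᵀ : ξ ∈ ℝ^{n+1}, ξ₁ = 0} is the top-left (n+1)×(n+1) block of X, then the difference i'(Z) − X lies in Λ²F̄. (This makes precise the statement of Lemma 4.1 that the differences Z − Z̃ between the projective and conformal duals of a basis lie in Λ²F̄ ⊆ g^⊥, which is the mechanism behind Lemma 4.1 and Proposition 3.4.) -/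
open Matrix

noncomputable section

/-- if `X ∈ f̂` and its top-left block `Z` lies in `p₊`, then
`i'(Z) − X ∈ Λ²F̄`. -/
theorem stmt12 (n : ℕ) (hn : 2 ≤ n) (X : Matrix (Idx n) (Idx n) ℝ)
    (hX : X ∈ fhat n) (hZ : topLeft X ∈ pplus n) :
    iEmb (topLeft X) - X ∈ Lam2Fbar n := by
  obtain ⟨⟨hso, hv, -⟩, hB⟩ := hX
  obtain ⟨ξ, -, hZ⟩ := hZ
  obtain ⟨A, B, C, D, rfl⟩ : ∃ A B C D, X = fromBlocks A B C D :=
    ⟨_, _, _, _, (fromBlocks_toBlocks X).symm⟩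
  obtain rfl : B = 0 := Matrix.ext fun i j => hB i j
  have hA : topLeft (fromBlocks A 0 C D) = A := rfl
  rw [hA] at hZ ⊢
  simp only [soSplit, Jmat, Set.mem_ofPred_eq, fromBlocks_transpose, fromBlocks_multiply,
    fromBlocks_add, ← fromBlocks_zero, fromBlocks_inj, mul_zero, mul_one, zero_mul, one_mul,
    zero_add, add_zero] at hso
  obtain ⟨hC, hD, -, -⟩ := hso
  have hD' : D = -Aᵀ := eq_neg_of_add_eq_zero_right hD
  have hC' : Cᵀ = -C := eq_neg_of_add_eq_zero_left hC
  refine ⟨-C, by rw [transpose_neg, hC'], ?_, ?_⟩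
  · ext i
    have hi := congrFun hv (Sum.inr i)
    have hlast : Fin.last n ≠ 0 := by simp only [ne_eq, Fin.ext_iff, Fin.val_last, Fin.val_zero]; omega
    simpa [vtil, mulVec_add, hD', hZ, vecMulVec_apply, hlast] using hi
  · rw [iEmb, hD', sub_eq_add_neg, fromBlocks_neg, fromBlocks_add]
    simp
end
end

section
/- The tractor endomorphism K with slots (ρ, μ|φ, k) satisfies K ∘ K = id if and only if the six relations of eq. (B.2) hold: g(k,k) = 0, g(ρ,ρ) = 0, μ(k) = φ·k, μ(ρ) = −φ·ρ, g(k,ρ) = φ² − 1, and μ(μ(ω)) = ω + g(ρ,ω)·k + g(k,ω)·ρ for all ω ∈ V. -/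
noncomputable section

/-- The adjoint-tractor action of the triple of slots `(ρ, μ|φ, k)` on a standard
tractor `(ν, ω, σ)`, eq. (2.16): `K(ν, ω, σ) = (g(ρ,ω) − φν, μ(ω) − σρ − νk, g(k,ω) + φσ)`. -/
def Ktr {V : Type*} [AddCommGroup V] [Module ℝ V]
    (g : LinearMap.BilinForm ℝ V) (k ρ : V) (φ : ℝ) (μ : V →ₗ[ℝ] V) :
    ℝ × V × ℝ → ℝ × V × ℝ :=
  fun x => (g ρ x.2.1 - φ * x.1, μ x.2.1 - x.2.2 • ρ - x.1 • k, g k x.2.1 + φ * x.2.2)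

/-- the tractor endomorphism `K` with slots `(ρ, μ|φ, k)` satisfies
`K ∘ K = id` if and only if the six relations of eq. (B.2) hold. -/
theorem stmt14 (V : Type*) [AddCommGroup V] [Module ℝ V] [FiniteDimensional ℝ V]
    (g : LinearMap.BilinForm ℝ V)
    (hsymm : ∀ x y : V, g x y = g y x)
    (hnondeg : ∀ x : V, (∀ y : V, g x y = 0) → x = 0)
    (k ρ : V) (φ : ℝ) (μ : V →ₗ[ℝ] V)
    (hskew : ∀ x y : V, g (μ x) y = - g x (μ y)) :
    (∀ x : ℝ × V × ℝ, Ktr g k ρ φ μ (Ktr g k ρ φ μ x) = x) ↔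
      (g k k = 0 ∧
       g ρ ρ = 0 ∧
       μ k = φ • k ∧
       μ ρ = (-φ) • ρ ∧
       g k ρ = φ ^ 2 - 1 ∧
       ∀ ω : V, μ (μ ω) = ω + g ρ ω • k + g k ω • ρ) := by
  constructor
  · intro h
    have hν := h (1, 0, 0)
    have hσ := h (0, 0, 1)
    simp only [Ktr, Prod.mk.injEq, map_zero, map_sub, zero_smul, one_smul] at hν hσ
    obtain ⟨hν₁, hν₂, hν₃⟩ := hν
    obtain ⟨hσ₁, hσ₂, -⟩ := hσ
    refine ⟨by linarith, by linarith, ?_, ?_, by rw [hsymm]; linarith, fun ω => ?_⟩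
    · linear_combination (norm := module) (-1 : ℝ) • hν₂
    · linear_combination (norm := module) (-1 : ℝ) • hσ₂
    · have hω := congrArg (fun x => x.2.1) (h (0, ω, 0))
      simp only [Ktr, zero_smul, sub_zero, mul_zero, add_zero] at hω
      linear_combination (norm := module) hω
  · rintro ⟨hkk, hρρ, hμk, hμρ, hkρ, hμμ⟩ ⟨ν, ω, σ⟩
    have hρω : g ρ (μ ω) = φ * g ρ ω := by
      have := hskew ρ ω
      simp only [hμρ, map_smul, LinearMap.smul_apply, smul_eq_mul] at this
      linarith
    have hkω : g k (μ ω) = -(φ * g k ω) := by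
      have := hskew k ω
      simp only [hμk, map_smul, LinearMap.smul_apply, smul_eq_mul] at this
      linarith
    have hρk : g ρ k = φ ^ 2 - 1 := by rw [hsymm, hkρ]
    simp only [Ktr, Prod.mk.injEq, map_sub, map_smul, smul_eq_mul, hμμ, hμk, hμρ, hρω, hkω,
      hkk, hρρ, hkρ, hρk]
    exact ⟨by ring, by module, by ring⟩
end
end

section
/- The parabolic subgroup P acts transitively by conjugation on the nonzero elements of p₊: for any nonzero Z, Z' ∈ p₊ := {e₁ξᵀ : ξ ∈ ℝ^{n+1}, ξ₁ = 0} there exists p ∈ P := {g ∈ SL(n+1,ℝ) : g e₁ ∈ ℝ₊ e₁} with p Z p⁻¹ = Z'. (This is the algebraic core of Proposition 3.1: P acts transitively on p₊ ∖ {0} with stabilizer conjugate to Q, identifying the Fefferman space with the weighted cotangent bundle minus the zero section.) -/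
open Matrix

noncomputable section

/-- A covector `ξ` is carried to `ξ'` by a unimodular matrix fixing the first basis vector. -/
def UnimodularCarries {m : ℕ} (ξ ξ' : Fin (m + 1) → ℝ) : Prop :=
  ∃ p : Matrix (Fin (m + 1)) (Fin (m + 1)) ℝ,
    p.det = 1 ∧ p *ᵥ Pi.single 0 1 = Pi.single 0 1 ∧ ξ' ᵥ* p = ξ

theorem UnimodularCarries.trans {m : ℕ} {ξ η ζ : Fin (m + 1) → ℝ}
    (h₁ : UnimodularCarries ξ η) (h₂ : UnimodularCarries η ζ) : UnimodularCarries ξ ζ := by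
  obtain ⟨p, hp, hpe, hpξ⟩ := h₁
  obtain ⟨q, hq, hqe, hqη⟩ := h₂
  refine ⟨q * p, by rw [det_mul, hp, hq, one_mul], ?_, ?_⟩
  · rw [← mulVec_mulVec, hpe, hqe]
  · rw [← vecMul_vecMul, hqη, hpξ]

/-- Covectors sharing a nonzero coordinate are related by a transvection. -/
theorem UnimodularCarries.of_apply_eq {m : ℕ} {ξ ξ' : Fin (m + 1) → ℝ} (i : Fin (m + 1))
    (h₀ : ξ 0 = ξ' 0) (hi : ξ i = ξ' i) (hne : ξ' i ≠ 0) : UnimodularCarries ξ ξ' := by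
  refine ⟨1 + vecMulVec (Pi.single i 1) ((ξ' i)⁻¹ • (ξ - ξ')), ?_, ?_, ?_⟩
  · rw [vecMulVec_eq Unit, det_one_add_replicateCol_mul_replicateRow]
    simp [hi]
  · rw [add_mulVec, one_mulVec, vecMulVec_mulVec]
    simp [h₀]
  · rw [vecMul_add, vecMul_one, vecMul_vecMulVec]
    simp [smul_smul, hne]

theorem UnimodularCarries.of_ne {m : ℕ} {ξ ξ' : Fin (m + 1) → ℝ} {i j : Fin (m + 1)}
    (h₀ : ξ 0 = 0) (h₀' : ξ' 0 = 0) (hi : ξ i ≠ 0) (hj : ξ' j ≠ 0) (hij : i ≠ j) :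
    UnimodularCarries ξ ξ' := by
  have hi₀ : 0 ≠ i := by rintro rfl; exact hi h₀
  have hj₀ : 0 ≠ j := by rintro rfl; exact hj h₀'
  exact (of_apply_eq (ξ' := Pi.single i (ξ i) + Pi.single j (ξ' j)) i
    (by simp [h₀, hi₀, hj₀]) (by simp [hij]) (by simpa [hij] using hi)).trans
    (of_apply_eq j (by simp [h₀', hi₀, hj₀]) (by simp [hij.symm]) hj)

theorem UnimodularCarries.of_ne_zero {m : ℕ} (hm : 2 ≤ m) {ξ ξ' : Fin (m + 1) → ℝ}
    (h₀ : ξ 0 = 0) (h₀' : ξ' 0 = 0) (hξ : ξ ≠ 0) (hξ' : ξ' ≠ 0) :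
    UnimodularCarries ξ ξ' := by
  obtain ⟨i, hi⟩ := Function.ne_iff.mp hξ
  obtain ⟨j, hj⟩ := Function.ne_iff.mp hξ'
  by_cases hij : i = j
  · subst hij
    obtain ⟨k, hk₀, hki⟩ : ∃ k : Fin (m + 1), k ≠ 0 ∧ k ≠ i := by
      have : ({0, i} : Finset (Fin (m + 1))).card < Fintype.card (Fin (m + 1)) := by
        rw [Fintype.card_fin]
        exact Finset.card_le_two.trans_lt (by omega)
      obtain ⟨k, hk⟩ := Finset.exists_mem_notMem_of_card_lt_card (this.trans_eq Finset.card_univ.symm)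
      exact ⟨k, by simpa using hk⟩
    have hη₀ : (Pi.single k 1 : Fin (m + 1) → ℝ) 0 = 0 := by simp [hk₀.symm]
    have hηk : (Pi.single k 1 : Fin (m + 1) → ℝ) k ≠ 0 := by simp
    exact (of_ne h₀ hη₀ hi hηk hki.symm).trans (of_ne hη₀ h₀' hηk hj hki)
  · exact of_ne h₀ h₀' hi hj hij

/-- the parabolic subgroup `P = {g ∈ SL(n+1,ℝ) : g e₁ ∈ ℝ₊ e₁}` acts
transitively by conjugation on the nonzero elements of `p₊`. -/
theorem stmt18 (n : ℕ) (hn : 2 ≤ n)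
    (Z Z' : Matrix (Fin (n + 1)) (Fin (n + 1)) ℝ)
    (hZ : Z ∈ pplus n) (hZ' : Z' ∈ pplus n) (hZ0 : Z ≠ 0) (hZ'0 : Z' ≠ 0) :
    ∃ p : Matrix (Fin (n + 1)) (Fin (n + 1)) ℝ,
      p.det = 1 ∧
      (∃ t : ℝ, 0 < t ∧ p.mulVec (Pi.single 0 1) = t • (Pi.single 0 1 : Fin (n + 1) → ℝ)) ∧
      p * Z * p⁻¹ = Z' := by
  obtain ⟨ξ, h₀, rfl⟩ := hZ
  obtain ⟨ξ', h₀', rfl⟩ := hZ'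
  obtain ⟨p, hp, hpe, hpξ⟩ := UnimodularCarries.of_ne_zero hn h₀ h₀'
    (by rintro rfl; simp at hZ0) (by rintro rfl; simp at hZ'0)
  refine ⟨p, hp, ⟨1, one_pos, by rw [hpe, one_smul]⟩, ?_⟩
  rw [mul_vecMulVec, hpe, ← hpξ, ← vecMulVec_mul, mul_nonsing_inv_cancel_right]
  simp [hp]
end
end
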